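/- arXiv:math/0602476 — 8 statements merged into one kernel-verified Lean document; each statement's English description precedes it below -/
import Mathlib

section
/- Let n ≥ 1 and let h : Fin n → ℕ. Define f : ℤ → ℤ by f(t) = t + h(t mod n). Then f is a bijection of ℤ if and only if the map Fin n → Fin n sending i to (i + h(i)) mod n is a bijection (equivalently, {h(i) + i mod n : 0 ≤ i < n} is a permutation of {0, 1, …, n−1}). -/
/-- A self-map of `ℤ` commuting with translation by `n` is bijective if and only if the map it
induces on residues modulo `n` is bijective. -/
theorem bijective_iff_of_map_add_mul {n : ℕ} (hn : 0 < n) {f : ℤ → ℤ} {g : Fin n → Fin n}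
    (hf : ∀ t k : ℤ, f (t + n * k) = f t + n * k)
    (hg : ∀ i : Fin n, ((g i : ℕ) : ℤ) = f (i : ℕ) % n) :
    Function.Bijective f ↔ Function.Bijective g := by
  have hn' : (0 : ℤ) < n := by exact_mod_cast hn
  have decomp (t : ℤ) : ∃ (i : Fin n) (k : ℤ), t = (i : ℕ) + n * k := by
    have h₀ := Int.emod_nonneg t hn'.ne'
    have h₁ := Int.emod_lt_of_pos t hn'
    refine ⟨⟨(t % n).toNat, by omega⟩, t / n, ?_⟩
    rw [Int.toNat_of_nonneg h₀, Int.emod_add_mul_ediv]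
  constructor
  · intro hbij
    refine Function.Surjective.bijective_of_finite fun j => ?_
    obtain ⟨t, ht⟩ := hbij.surjective (j : ℕ)
    obtain ⟨i, k, rfl⟩ := decomp t
    refine ⟨i, Fin.ext ?_⟩
    have hij : ((g i : ℕ) : ℤ) = (j : ℕ) := by
      rw [hg, ← Int.add_mul_emod_self_left (f (i : ℕ)) n k, ← hf, ht]
      exact Int.emod_eq_of_lt (by positivity) (by exact_mod_cast j.isLt)
    exact_mod_cast hij
  · intro hbij
    constructor
    · intro s t hst
      obtain ⟨i, k, rfl⟩ := decomp s
      obtain ⟨j, l, rfl⟩ := decomp t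
      rw [hf, hf] at hst
      have hij : i = j := by
        apply hbij.injective
        apply Fin.ext
        have hval : ((g i : ℕ) : ℤ) = (g j : ℕ) := by
          rw [hg, hg, ← Int.add_mul_emod_self_left (f (i : ℕ)) n k, hst,
            Int.add_mul_emod_self_left]
        exact_mod_cast hval
      subst hij
      rw [add_left_cancel hst]
    · intro y
      obtain ⟨j, k, rfl⟩ := decomp y
      obtain ⟨i, rfl⟩ := hbij.surjective j
      refine ⟨(i : ℕ) + n * (k - f (i : ℕ) / n), ?_⟩
      rw [hf, hg]
      linear_combination -Int.emod_add_mul_ediv (f (i : ℕ)) n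


/-- A juggling sequence `h : Fin n → ℕ` is valid (its associated map
`f(t) = t + h(t mod n)` is a bijection of `ℤ`) if and only if
`i ↦ (i + h i) mod n` is a bijection of `Fin n`. -/
theorem juggling_bijective_iff (n : ℕ) (hn : 0 < n) (h : Fin n → ℕ) :
    Function.Bijective
      (fun t : ℤ => t + (h ⟨(t % (n : ℤ)).toNat, by
        have h2 := Int.emod_lt_of_pos t (by exact_mod_cast hn : (0:ℤ) < (n:ℤ))
        omega⟩ : ℤ)) ↔
    Function.Bijective
      (fun i : Fin n => (⟨((i : ℕ) + h i) % n, Nat.mod_lt _ hn⟩ : Fin n)) := by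
  refine bijective_iff_of_map_add_mul hn (fun t k => ?_) fun i => ?_
  · simp only [Int.add_mul_emod_self_left]
    ring
  · have hi : ((i : ℕ) : ℤ) % n = (i : ℕ) :=
      Int.emod_eq_of_lt (by positivity) (by exact_mod_cast i.isLt)
    simp [hi]
end

section
/- Let n ≥ 1 and let h : Fin n → ℕ be such that f : ℤ → ℤ, f(t) = t + h(t mod n), is a bijection. Then for every t ∈ ℤ the set B(t) = { s ∈ ℤ : s ≤ t and f(s) > t } (the balls in the air just after beat t) is finite, and n · |B(t)| = Σ_{i=0}^{n−1} h(i); in particular |B(t)| is independent of t and equals the average of the throw values. -/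
theorem Function.Periodic.sum_range_sub_natCast {M : Type*} [AddCancelCommMonoid M] {g : ℤ → M}
    {n : ℕ} (hg : Function.Periodic g n) (j : ℕ) :
    ∑ i ∈ Finset.range n, g (i - j) = ∑ i ∈ Finset.range n, g i := by
  induction j with
  | zero => simp
  | succ j ih =>
    rw [← ih]
    have h₁ := Finset.sum_range_succ (fun i : ℕ => g (i - (j + 1 : ℕ))) n
    have h₂ := Finset.sum_range_succ' (fun i : ℕ => g (i - (j + 1 : ℕ))) n
    have h₃ : g ((n : ℤ) - (j + 1 : ℕ)) = g (((0 : ℕ) : ℤ) - (j + 1 : ℕ)) := by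
      rw [← hg (((0 : ℕ) : ℤ) - (j + 1 : ℕ)), Nat.cast_zero, zero_sub, neg_add_eq_sub]
    have h₄ (i : ℕ) : g (((i + 1 : ℕ) : ℤ) - (j + 1 : ℕ)) = g (i - j) := by
      congr 1
      push_cast
      ring
    simp only [h₄] at h₂
    rw [h₁, h₃] at h₂
    exact add_right_cancel h₂

namespace Juggling

/-- The beats `s ≤ t` whose throw, of height `k s < M`, is still in the air after beat `t`. -/
theorem ballsInAir_eq_image {k : ℤ → ℕ} {M : ℕ} (hM : ∀ s, k s < M) (t : ℤ) :
    {s : ℤ | s ≤ t ∧ t < s + k s} =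
      ((Finset.range M).filter fun j : ℕ => j < k (t - j)).image fun j : ℕ => t - (j : ℤ) := by
  ext s
  simp only [Set.mem_ofPred_eq, Finset.coe_image, Finset.coe_filter, Finset.mem_range,
    Set.mem_image]
  constructor
  · rintro ⟨hs, hts⟩
    have hMs := hM s
    have hsub : t - ((t - s).toNat : ℤ) = s := by omega
    exact ⟨(t - s).toNat, ⟨by omega, by rw [hsub]; omega⟩, hsub⟩
  · rintro ⟨j, ⟨-, hj⟩, rfl⟩
    omega

theorem ballsInAir_finite {k : ℤ → ℕ} {M : ℕ} (hM : ∀ s, k s < M) (t : ℤ) :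
    {s : ℤ | s ≤ t ∧ t < s + k s}.Finite := by
  rw [ballsInAir_eq_image hM]
  exact Finset.finite_toSet _

theorem ncard_ballsInAir_eq_sum {k : ℤ → ℕ} {M : ℕ} (hM : ∀ s, k s < M) (t : ℤ) :
    {s : ℤ | s ≤ t ∧ t < s + k s}.ncard =
      ∑ j ∈ Finset.range M, if j < k (t - j) then 1 else 0 := by
  rw [ballsInAir_eq_image hM, Set.ncard_coe_finset, Finset.card_image_of_injective,
    Finset.card_filter]
  intro a b hab
  simpa using hab

theorem ncard_ballsInAir_succ {k : ℤ → ℕ} {M : ℕ} (hM : ∀ s, k s < M)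
    (hbij : Function.Bijective fun s => s + (k s : ℤ)) (t : ℤ) :
    {s : ℤ | s ≤ t + 1 ∧ t + 1 < s + k s}.ncard = {s : ℤ | s ≤ t ∧ t < s + k s}.ncard := by
  obtain ⟨p, hp⟩ := hbij.surjective (t + 1)
  have hinsert : insert p {s : ℤ | s ≤ t + 1 ∧ t + 1 < s + k s} =
      insert (t + 1) {s : ℤ | s ≤ t ∧ t < s + k s} := by
    ext s
    have hs : s + (k s : ℤ) = t + 1 ↔ s = p := by
      rw [← hp]
      exact hbij.injective.eq_iff
    simp only [Set.mem_insert_iff, Set.mem_ofPred_eq, ← hs]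
    omega
  have hcard := congrArg Set.ncard hinsert
  rw [Set.ncard_insert_of_notMem (fun hmem => hmem.2.ne' hp) (ballsInAir_finite hM _),
    Set.ncard_insert_of_notMem (fun hmem => by have := hmem.1; omega) (ballsInAir_finite hM _)]
    at hcard
  exact Nat.add_right_cancel hcard

theorem ncard_ballsInAir_eq {k : ℤ → ℕ} {M : ℕ} (hM : ∀ s, k s < M)
    (hbij : Function.Bijective fun s => s + (k s : ℤ)) (t : ℤ) :
    {s : ℤ | s ≤ t ∧ t < s + k s}.ncard = {s : ℤ | s ≤ 0 ∧ 0 < s + (k s : ℤ)}.ncard := by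
  induction t using Int.induction_on with
  | zero => rfl
  | succ t ih => rw [ncard_ballsInAir_succ hM hbij, ih]
  | pred t ih =>
    rw [← ncard_ballsInAir_succ hM hbij, sub_add_cancel, ih]

theorem sum_ncard_ballsInAir {k : ℤ → ℕ} {M n : ℕ} (hM : ∀ s, k s < M)
    (hk : Function.Periodic k n) :
    ∑ t ∈ Finset.range n, {s : ℤ | s ≤ t ∧ t < s + k s}.ncard =
      ∑ t ∈ Finset.range n, k t := by
  simp only [ncard_ballsInAir_eq_sum hM]
  rw [Finset.sum_comm]
  have hshift (j : ℕ) : ∑ t ∈ Finset.range n, (if j < k (t - j) then 1 else 0) =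
      ∑ t ∈ Finset.range n, if j < k t then 1 else 0 :=
    (hk.comp fun m => if j < m then 1 else 0).sum_range_sub_natCast j
  simp only [hshift]
  rw [Finset.sum_comm]
  refine Finset.sum_congr rfl fun t _ => ?_
  have hfilter : (Finset.range M).filter (· < k t) = Finset.range (k t) := by
    ext j
    have := hM t
    simp only [Finset.mem_filter, Finset.mem_range]
    omega
  rw [← Finset.card_filter, hfilter, Finset.card_range]

theorem mul_ncard_ballsInAir {k : ℤ → ℕ} {M n : ℕ} (hM : ∀ s, k s < M)
    (hk : Function.Periodic k n) (hbij : Function.Bijective fun s => s + (k s : ℤ)) (t : ℤ) :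
    n * {s : ℤ | s ≤ t ∧ t < s + k s}.ncard = ∑ i ∈ Finset.range n, k i := by
  rw [← sum_ncard_ballsInAir hM hk]
  simp only [ncard_ballsInAir_eq hM hbij, Finset.sum_const, Finset.card_range, smul_eq_mul]

end Juggling

/-- For a valid juggling sequence `h : Fin n → ℕ` with associated bijection
`f(t) = t + h(t mod n)`, the set of balls in the air just after beat `t`,
`B(t) = {s ≤ t : f(s) > t}`, is finite and `n * |B(t)| = Σ h(i)`; in
particular `|B(t)|` equals the average of the throw values. -/
theorem balls_in_air_card (n : ℕ) (hn : 0 < n) (h : Fin n → ℕ) (f : ℤ → ℤ)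
    (hf : ∀ t : ℤ, f t = t + (h ⟨(t % (n : ℤ)).toNat, by
      have h2 := Int.emod_lt_of_pos t (by exact_mod_cast hn : (0:ℤ) < (n:ℤ))
      omega⟩ : ℤ))
    (hbij : Function.Bijective f) :
    ∀ t : ℤ, {s : ℤ | s ≤ t ∧ t < f s}.Finite ∧
      n * {s : ℤ | s ≤ t ∧ t < f s}.ncard = ∑ i : Fin n, h i := by
  have hmod (t : ℤ) : (t % (n : ℤ)).toNat < n := by
    have := Int.emod_lt_of_pos t (by exact_mod_cast hn : (0 : ℤ) < n)
    omega
  let k : ℤ → ℕ := fun t => h ⟨(t % (n : ℤ)).toNat, hmod t⟩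
  obtain rfl : f = fun s => s + (k s : ℤ) := funext hf
  have hM (s : ℤ) : k s < ∑ i, h i + 1 :=
    Nat.lt_succ_of_le (Finset.single_le_sum (fun i _ => Nat.zero_le (h i)) (Finset.mem_univ _))
  have hk : Function.Periodic k n := fun t => by simp [k]
  have hsum : ∑ i ∈ Finset.range n, k i = ∑ i, h i := by
    rw [Finset.sum_range]
    refine Finset.sum_congr rfl fun i _ => congrArg h (Fin.ext ?_)
    have := Int.emod_eq_of_lt (Int.natCast_nonneg (i : ℕ)) (by exact_mod_cast i.isLt : (i : ℤ) < n)
    simp [this]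
  intro t
  exact ⟨Juggling.ballsInAir_finite hM t, (Juggling.mul_ncard_ballsInAir hM hk hbij t).trans hsum⟩
end

section
/- Let n ≥ 1 and let h : Fin n → ℕ. If the map Fin n → Fin n sending i to (i + h(i)) mod n is a bijection, then n divides Σ_{i=0}^{n−1} h(i); that is, the average of the throw values h(0), …, h(n−1) is an integer. -/
/-- If `i ↦ (i + h i) mod n` is a bijection of `Fin n`, then `n` divides the
sum of the throw values `h(0), …, h(n−1)`; i.e. their average is an integer. -/
theorem average_is_integer (n : ℕ) (hn : 0 < n) (h : Fin n → ℕ)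
    (hbij : Function.Bijective
      (fun i : Fin n => (⟨((i : ℕ) + h i) % n, Nat.mod_lt _ hn⟩ : Fin n))) :
    n ∣ ∑ i : Fin n, h i := by
  have key : ∑ i : Fin n, (((i : ℕ) + h i) % n) = ∑ i : Fin n, (i : ℕ) :=
    hbij.sum_comp (fun j : Fin n => (j : ℕ))
  have key' := congrArg (Nat.cast : ℕ → ZMod n) key
  rw [← ZMod.natCast_eq_zero_iff]
  simpa [Finset.sum_add_distrib] using key'
end

section
/- Let n ≥ 1 and let h : Fin n → ℕ be such that f : ℤ → ℤ, f(t) = t + h(t mod n), is a bijection. Let a, b be integers with 0 ≤ a < b ≤ n−1 and b − a ≤ h(a). Define g : Fin n → ℕ by g(a) = h(b) + (b − a), g(b) = h(a) − (b − a), and g(i) = h(i) for all i ≠ a, b. Then the map ℤ → ℤ, t ↦ t + g(t mod n), is also a bijection; i.e., g is again a valid juggling sequence (the site swap of h at positions a and b). -/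
theorem toNat_emod_lt {n : ℕ} (hn : 0 < n) (t : ℤ) : (t % (n : ℤ)).toNat < n := by
  have h2 := Int.emod_lt_of_pos t (Int.natCast_pos.mpr hn)
  omega

/-- The residue of an integer beat modulo the period. -/
def beatResidue (n : ℕ) (hn : 0 < n) (t : ℤ) : Fin n :=
  ⟨(t % (n : ℤ)).toNat, toNat_emod_lt hn t⟩

theorem beatResidue_add_sub {n : ℕ} (hn : 0 < n) {t : ℤ} {i : Fin n}
    (ht : beatResidue n hn t = i) (j : Fin n) :
    beatResidue n hn (t + ((j : ℕ) - (i : ℕ))) = j := by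
  subst ht
  have hn' : (n : ℤ) ≠ 0 := by exact_mod_cast hn.ne'
  have hcast : ((beatResidue n hn t : ℕ) : ℤ) = t % n :=
    Int.toNat_of_nonneg (Int.emod_nonneg t hn')
  have hdiv := Int.emod_add_mul_ediv t n
  have hj : (t + ((j : ℕ) - (beatResidue n hn t : ℕ) : ℤ)) % n = (j : ℕ) := by
    rw [hcast, show t + ((j : ℕ) - t % n : ℤ) = (j : ℕ) + n * (t / n) by linarith,
      Int.add_mul_emod_self_left]
    exact Int.emod_eq_of_lt (by positivity) (by exact_mod_cast j.isLt)
  apply Fin.ext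
  change ((t + ((j : ℕ) - (beatResidue n hn t : ℕ) : ℤ)) % n).toNat = j
  rw [hj, Int.toNat_natCast]

/-- The permutation of the beats exchanging the residue classes of `a` and `b`
by translation. -/
def swapBeats (n : ℕ) (hn : 0 < n) (a b : Fin n) (t : ℤ) : ℤ :=
  t + ((Equiv.swap a b (beatResidue n hn t) : ℕ) - (beatResidue n hn t : ℕ))

theorem beatResidue_swapBeats {n : ℕ} (hn : 0 < n) (a b : Fin n) (t : ℤ) :
    beatResidue n hn (swapBeats n hn a b t) = Equiv.swap a b (beatResidue n hn t) :=
  beatResidue_add_sub hn rfl _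

theorem swapBeats_involutive {n : ℕ} (hn : 0 < n) (a b : Fin n) :
    Function.Involutive (swapBeats n hn a b) := by
  intro t
  rw [swapBeats, beatResidue_swapBeats, Equiv.swap_apply_self, swapBeats]
  ring


/-- Site swap: if `h : Fin n → ℕ` is a valid juggling sequence, `a < b` are
positions with `b − a ≤ h(a)`, and `g` is obtained from `h` by setting
`g(a) = h(b) + (b − a)`, `g(b) = h(a) − (b − a)` and `g(i) = h(i)` otherwise,
then `g` is again a valid juggling sequence. -/
theorem site_swap_valid (n : ℕ) (hn : 0 < n) (h g : Fin n → ℕ)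
    (hbij : Function.Bijective
      (fun t : ℤ => t + (h ⟨(t % (n : ℤ)).toNat, by
        have h2 := Int.emod_lt_of_pos t (by exact_mod_cast hn : (0:ℤ) < (n:ℤ))
        omega⟩ : ℤ)))
    (a b : Fin n) (hab : (a : ℕ) < (b : ℕ)) (hthrow : (b : ℕ) - (a : ℕ) ≤ h a)
    (hga : g a = h b + ((b : ℕ) - (a : ℕ)))
    (hgb : g b = h a - ((b : ℕ) - (a : ℕ)))
    (hgi : ∀ i : Fin n, i ≠ a → i ≠ b → g i = h i) :
    Function.Bijective
      (fun t : ℤ => t + (g ⟨(t % (n : ℤ)).toNat, by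
        have h2 := Int.emod_lt_of_pos t (by exact_mod_cast hn : (0:ℤ) < (n:ℤ))
        omega⟩ : ℤ)) := by
  convert hbij.comp (swapBeats_involutive hn a b).bijective using 1
  funext t
  change t + (g (beatResidue n hn t) : ℤ) =
    swapBeats n hn a b t + (h (beatResidue n hn (swapBeats n hn a b t)) : ℤ)
  rw [beatResidue_swapBeats, swapBeats]
  by_cases ha : beatResidue n hn t = a
  · rw [ha, Equiv.swap_apply_left]
    omega
  by_cases hb : beatResidue n hn t = b
  · rw [hb, Equiv.swap_apply_right]
    omega
  rw [Equiv.swap_apply_of_ne_of_ne ha hb, hgi _ ha hb]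
  ring
end

section
/- Fix n ≥ 1. For k ≥ 1 let α_k = Σ_{j=0}^{k−2} 9^j. Define d : ℤ → ℕ by d(t) = 3^{2k−1} if t ≡ α_k (mod 3^{2k−1}) for some k ∈ {1,…,n}, and d(t) = 0 otherwise (this is well defined since these congruence classes are pairwise disjoint). Then the map I_n : ℤ → ℤ, I_n(t) = t + d(t), is a bijection of ℤ; i.e., I_n is a valid juggling pattern. -/
/-- `jugAlpha k = Σ_{j=0}^{k-2} 9^j` is the first throw time of the `k`-th
ball in the trivial juggling pattern. -/
def jugAlpha (k : ℕ) : ℕ := ∑ j ∈ Finset.range (k - 1), 9 ^ j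

/-- If shifting `t` by `± d t` does not change the value of `d`, then `t ↦ t + d t` is a
bijection, with inverse `t ↦ t - d t`. -/
theorem bijective_add_of_shift_invariant {d : ℤ → ℤ} (hadd : ∀ t, d (t + d t) = d t)
    (hsub : ∀ t, d (t - d t) = d t) : Function.Bijective (fun t => t + d t) :=
  Function.bijective_iff_has_inverse.mpr
    ⟨fun t => t - d t, fun t => by simp [hadd], fun t => by simp [hsub]⟩

/-- The trivial pattern `I_n(t) = t + d(t)`, where `d(t) = 3^{2k−1}` if
`t ≡ α_k (mod 3^{2k−1})` for some `1 ≤ k ≤ n` and `d(t) = 0` otherwise,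
is a bijection of `ℤ`, i.e. a valid juggling pattern. -/
theorem trivial_pattern_bijective (n : ℕ) (hn : 1 ≤ n) (d : ℤ → ℕ)
    (hd1 : ∀ t : ℤ, ∀ k : ℕ, 1 ≤ k → k ≤ n →
      t ≡ (jugAlpha k : ℤ) [ZMOD (3 : ℤ) ^ (2 * k - 1)] → d t = 3 ^ (2 * k - 1))
    (hd0 : ∀ t : ℤ,
      (∀ k : ℕ, 1 ≤ k → k ≤ n → ¬ t ≡ (jugAlpha k : ℤ) [ZMOD (3 : ℤ) ^ (2 * k - 1)]) →
      d t = 0) :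
    Function.Bijective (fun t : ℤ => t + (d t : ℤ)) := by
  have shift : ∀ t : ℤ, d (t + d t) = d t ∧ d (t - d t) = d t := by
    intro t
    by_cases h : ∃ k : ℕ, 1 ≤ k ∧ k ≤ n ∧ t ≡ (jugAlpha k : ℤ) [ZMOD (3 : ℤ) ^ (2 * k - 1)]
    · obtain ⟨k, hk1, hkn, hk⟩ := h
      have hd : d t = 3 ^ (2 * k - 1) := hd1 t k hk1 hkn hk
      rw [hd]
      push_cast
      exact ⟨hd1 _ k hk1 hkn (by simpa [Int.ModEq] using hk),
        hd1 _ k hk1 hkn (by simpa [Int.ModEq] using hk)⟩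
    · push Not at h
      simp [hd0 t h]
  exact bijective_add_of_shift_invariant (d := fun t => (d t : ℤ))
    (fun t => by exact_mod_cast (shift t).1) (fun t => by exact_mod_cast (shift t).2)
end

section
/- Fix n ≥ 1 and let I_n : ℤ → ℤ be the trivial juggling pattern, I_n(t) = t + 3^{2k−1} if t ≡ α_k (mod 3^{2k−1}) for some k ∈ {1,…,n} and I_n(t) = t otherwise, where α_k = Σ_{j=0}^{k−2} 9^j. Then for every t ∈ ℤ the set { s ∈ ℤ : s ≤ t and I_n(s) > t } is finite of cardinality exactly n; i.e., I_n is an n-ball juggling pattern. -/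
/-- The difference of two first throw times is not divisible by the smaller period. -/
theorem jugAlpha_not_modEq_of_lt {j k : ℕ} (hj : 1 ≤ j) (hjk : j < k) :
    ¬ (jugAlpha j : ℤ) ≡ (jugAlpha k : ℤ) [ZMOD (3 : ℤ) ^ (2 * j - 1)] := by
  obtain ⟨a, rfl⟩ := Nat.exists_eq_add_of_le' hj
  obtain ⟨d, rfl⟩ := Nat.exists_eq_add_of_lt hjk
  have hk : jugAlpha (a + 1 + d + 1)
      = jugAlpha (a + 1) + 9 ^ a * (1 + 9 * ∑ i ∈ Finset.range d, 9 ^ i) := by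
    have h : a + 1 + d + 1 - 1 = a + (d + 1) := by omega
    rw [jugAlpha, jugAlpha, h, Finset.sum_range_add, Nat.add_sub_cancel]
    simp_rw [pow_add 9 a]
    rw [← Finset.mul_sum, geom_sum_succ, add_comm 1]
  have hm : (3 : ℤ) ^ (2 * (a + 1) - 1) = 9 ^ a * 3 := by
    rw [show 2 * (a + 1) - 1 = 2 * a + 1 by omega, pow_succ, pow_mul]
    norm_num
  rw [Int.modEq_iff_dvd, hk, hm]
  push_cast
  rw [add_sub_cancel_left, mul_dvd_mul_iff_left (by positivity)]
  omega

/-- The residue classes of throw times of distinct balls are disjoint. -/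
theorem eq_of_modEq_jugAlpha {j k : ℕ} (hj : 1 ≤ j) (hk : 1 ≤ k) {s : ℤ}
    (hsj : s ≡ (jugAlpha j : ℤ) [ZMOD (3 : ℤ) ^ (2 * j - 1)])
    (hsk : s ≡ (jugAlpha k : ℤ) [ZMOD (3 : ℤ) ^ (2 * k - 1)]) : j = k := by
  rcases lt_trichotomy j k with h | h | h
  · exact absurd (hsj.symm.trans (hsk.of_dvd (pow_dvd_pow 3 (by omega))))
      (jugAlpha_not_modEq_of_lt hj h)
  · exact h
  · exact absurd (hsk.symm.trans (hsj.of_dvd (pow_dvd_pow 3 (by omega))))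
      (jugAlpha_not_modEq_of_lt hk h)

/-- The last time `s ≤ t` with `s ≡ a [ZMOD m]`. -/
def lastModEq (a m t : ℤ) : ℤ := t - (t - a) % m

theorem lastModEq_modEq (a m t : ℤ) : lastModEq a m t ≡ a [ZMOD m] := by
  have h : lastModEq a m t - a = m * ((t - a) / m) := by
    rw [lastModEq]
    linarith [Int.emod_add_mul_ediv (t - a) m]
  exact (Int.modEq_iff_dvd.2 ⟨_, h⟩).symm

theorem lastModEq_le (a t : ℤ) {m : ℤ} (hm : 0 < m) : lastModEq a m t ≤ t := by
  rw [lastModEq]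
  linarith [Int.emod_nonneg (t - a) hm.ne']

theorem lt_lastModEq_add (a t : ℤ) {m : ℤ} (hm : 0 < m) : t < lastModEq a m t + m := by
  rw [lastModEq]
  linarith [Int.emod_lt_of_pos (t - a) hm]

theorem eq_lastModEq {a m t s : ℤ} (hs : s ≡ a [ZMOD m]) (hle : s ≤ t) (hlt : t < s + m) :
    s = lastModEq a m t := by
  have h : (t - a) % m = t - s :=
    (Int.ModEq.sub_left t hs.symm).eq.trans (Int.emod_eq_of_lt (by linarith) (by linarith))
  rw [lastModEq, h, sub_sub_cancel]

/-- The trivial juggling pattern `I_n` (with `I_n(t) = t + 3^{2k−1}` if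
`t ≡ α_k (mod 3^{2k−1})` for some `1 ≤ k ≤ n`, and `I_n(t) = t` otherwise)
is an `n`-ball pattern: for every beat `t`, the set of balls in the air
`{s ≤ t : I_n(s) > t}` is finite of cardinality exactly `n`. -/
theorem trivial_pattern_n_balls (n : ℕ) (hn : 1 ≤ n) (I : ℤ → ℤ)
    (hI1 : ∀ t : ℤ, ∀ k : ℕ, 1 ≤ k → k ≤ n →
      t ≡ (jugAlpha k : ℤ) [ZMOD (3 : ℤ) ^ (2 * k - 1)] → I t = t + 3 ^ (2 * k - 1))
    (hI0 : ∀ t : ℤ,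
      (∀ k : ℕ, 1 ≤ k → k ≤ n → ¬ t ≡ (jugAlpha k : ℤ) [ZMOD (3 : ℤ) ^ (2 * k - 1)]) →
      I t = t) :
    ∀ t : ℤ, {s : ℤ | s ≤ t ∧ t < I s}.Finite ∧
      {s : ℤ | s ≤ t ∧ t < I s}.ncard = n := by
  intro t
  let throwTime (k : ℕ) : ℤ := lastModEq (jugAlpha k) (3 ^ (2 * k - 1)) t
  have hset : {s : ℤ | s ≤ t ∧ t < I s} = ((Finset.Icc 1 n).image throwTime : Set ℤ) := by
    ext s
    simp only [Set.mem_ofPred_eq, Finset.coe_image, Finset.coe_Icc, Set.mem_image, Set.mem_Icc]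
    constructor
    · rintro ⟨hle, hlt⟩
      by_contra! hne
      refine absurd (hI0 s fun k hk hkn hs => hne k ⟨hk, hkn⟩ ?_) (by linarith)
      rw [hI1 s k hk hkn hs] at hlt
      exact (eq_lastModEq hs hle hlt).symm
    · rintro ⟨k, ⟨hk, hkn⟩, rfl⟩
      have hm : (0 : ℤ) < 3 ^ (2 * k - 1) := by positivity
      refine ⟨lastModEq_le _ _ hm, ?_⟩
      rw [hI1 _ k hk hkn (lastModEq_modEq _ _ _)]
      exact lt_lastModEq_add _ _ hm
  have hinj : Set.InjOn throwTime (Finset.Icc 1 n) := by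
    intro j hj k hk hjk
    rw [Finset.mem_coe, Finset.mem_Icc] at hj hk
    refine eq_of_modEq_jugAlpha hj.1 hk.1 (lastModEq_modEq _ _ t) ?_
    change throwTime j ≡ _ [ZMOD _]
    rw [hjk]
    exact lastModEq_modEq _ _ t
  rw [hset]
  refine ⟨Finset.finite_toSet _, ?_⟩
  rw [Set.ncard_coe_finset, Finset.card_image_of_injOn hinj, Nat.card_Icc, Nat.add_sub_cancel]
end

section
/- Fix n ≥ 2 and 1 ≤ k ≤ n−1. Let α_j = Σ_{i=0}^{j−2} 9^i, let N = 2·3^{2n−1}, let a = α_{k+1}, b = α_k + 3^{2k+1}, and δ = b − a = 26·3^{2k−2}. Define d_C : ℤ → ℕ by: d_C(t) = 3^{2k−1} + δ if t ≡ a (mod N); d_C(t) = 3^{2k−2} if t ≡ b (mod N); and otherwise d_C(t) = 3^{2j−1} if t ≡ α_j (mod 3^{2j−1}) for some j ∈ {1,…,n}, and d_C(t) = 0 if no such j exists. Then the map C_{k,n} : ℤ → ℤ, C_{k,n}(t) = t + d_C(t), is a bijection of ℤ; i.e., C_{k,n} is a valid juggling pattern. -/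
theorem jugAlpha_succ {k : ℕ} (hk : 1 ≤ k) :
    jugAlpha (k + 1) = jugAlpha k + 3 ^ (2 * k - 2) := by
  obtain ⟨k, rfl⟩ := Nat.exists_eq_add_of_le' hk
  have h : 2 * (k + 1) - 2 = 2 * k := by omega
  simp [jugAlpha, Finset.sum_range_succ, h, pow_mul]

/-- Past index `i`, the partial sums `jugAlpha` are constant modulo `9 ^ i`. -/
theorem jugAlpha_modEq {i j : ℕ} (hij : i < j) :
    (jugAlpha j : ℤ) ≡ jugAlpha (i + 1) [ZMOD 9 ^ i] := by
  induction j, hij using Nat.le_induction with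
  | base => rfl
  | succ j hij ih =>
    rw [jugAlpha_succ (by omega)]
    have h : (9 : ℤ) ^ i ∣ 3 ^ (2 * j - 2) := by
      rw [show 2 * j - 2 = 2 * (j - 1) by omega, pow_mul]
      exact pow_dvd_pow 9 (by omega)
    push_cast
    simpa using ih.add (Int.modEq_zero_iff_dvd.2 h)

theorem not_modEq_jugAlpha_of_lt {i j : ℕ} (hi : 1 ≤ i) (hij : i < j) {t : ℤ}
    (hti : t ≡ jugAlpha i [ZMOD 3 ^ (2 * i - 1)]) :
    ¬ t ≡ jugAlpha j [ZMOD 3 ^ (2 * j - 1)] := by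
  intro htj
  have hdvd : (3 : ℤ) ^ (2 * i - 1) ∣ 9 ^ i := by
    rw [show (9 : ℤ) = 3 ^ 2 by norm_num, ← pow_mul]
    exact pow_dvd_pow 3 (by omega)
  have h := (hti.symm.trans (htj.of_dvd (pow_dvd_pow 3 (by omega)))).trans
    ((jugAlpha_modEq hij).of_dvd hdvd)
  rw [jugAlpha_succ hi] at h
  have h' := h.dvd
  push_cast at h'
  rw [add_sub_cancel_left, pow_dvd_pow_iff (by norm_num) (by decide)] at h'
  omega

/-- The residue classes of the trivial pattern are pairwise disjoint. -/
theorem eq_of_modEq_jugAlpha_s9 {i j : ℕ} (hi : 1 ≤ i) (hj : 1 ≤ j) {t : ℤ}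
    (hti : t ≡ jugAlpha i [ZMOD 3 ^ (2 * i - 1)])
    (htj : t ≡ jugAlpha j [ZMOD 3 ^ (2 * j - 1)]) : i = j := by
  rcases lt_trichotomy i j with h | h | h
  · exact absurd htj (not_modEq_jugAlpha_of_lt hi h hti)
  · exact h
  · exact absurd hti (not_modEq_jugAlpha_of_lt hj h htj)

/-- The trivial pattern is a valid juggling pattern. -/
theorem trivial_pattern_bijective_s9 (n : ℕ) (e : ℤ → ℤ)
    (he : ∀ t : ℤ, ∀ j : ℕ, 1 ≤ j → j ≤ n →
      t ≡ jugAlpha j [ZMOD 3 ^ (2 * j - 1)] → e t = 3 ^ (2 * j - 1))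
    (he0 : ∀ t : ℤ, (∀ j : ℕ, 1 ≤ j → j ≤ n →
      ¬ t ≡ jugAlpha j [ZMOD 3 ^ (2 * j - 1)]) → e t = 0) :
    Function.Bijective fun t : ℤ => t + e t := by
  have key : ∀ t, e (t + e t) = e t ∧ e (t - e t) = e t := by
    intro t
    by_cases h : ∃ j : ℕ, 1 ≤ j ∧ j ≤ n ∧ t ≡ jugAlpha j [ZMOD 3 ^ (2 * j - 1)]
    · obtain ⟨j, h1, h2, h3⟩ := h
      rw [he t j h1 h2 h3]
      refine ⟨he _ j h1 h2 ?_, he _ j h1 h2 ?_⟩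
      · simpa [Int.ModEq] using h3
      · simpa [Int.ModEq] using h3
    · push Not at h
      simp [he0 t h]
  refine Function.bijective_iff_has_inverse.2 ⟨fun t => t - e t, fun t => ?_, fun t => ?_⟩
  · simp [(key t).1]
  · simp [(key t).2]

/-- Exchanging the residue classes of `a` and `b` modulo `N` by translations is an involution. -/
theorem swap_residues_involutive {N a b : ℤ} (hab : ¬ a ≡ b [ZMOD N]) :
    Function.Involutive fun t : ℤ =>
      if t ≡ a [ZMOD N] then t + (b - a) else if t ≡ b [ZMOD N] then t - (b - a) else t := by
  intro t
  by_cases h1 : t ≡ a [ZMOD N]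
  · have h2 : t + (b - a) ≡ b [ZMOD N] := by simpa using h1.add_right (b - a)
    have h3 : ¬ t + (b - a) ≡ a [ZMOD N] := fun h => hab (h.symm.trans h2)
    simp [h1, h2, h3]
  · by_cases h2 : t ≡ b [ZMOD N]
    · have h3 : t - (b - a) ≡ a [ZMOD N] := by simpa using h2.sub_right (b - a)
      simp [h1, h2, h3]
    · simp [h1, h2]

/-- The over-crossing pattern `C_{k,n}`, obtained from the trivial pattern
`I_n` by swapping (once per fundamental chamber of length `N = 2·3^{2n−1}`)
the sites at `a = α_{k+1}` and `b = α_k + 3^{2k+1}` (so `δ = b − a =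
26·3^{2k−2}`), is a bijection of `ℤ`, i.e. a valid juggling pattern. -/
theorem over_crossing_pattern_bijective (n k : ℕ) (hn : 2 ≤ n)
    (hk1 : 1 ≤ k) (hkn : k ≤ n - 1)
    (N a b δ : ℕ) (hN : N = 2 * 3 ^ (2 * n - 1))
    (ha : a = jugAlpha (k + 1)) (hb : b = jugAlpha k + 3 ^ (2 * k + 1))
    (hδ : δ = b - a) (hδ' : δ = 26 * 3 ^ (2 * k - 2))
    (d : ℤ → ℕ)
    (hda : ∀ t : ℤ, t ≡ (a : ℤ) [ZMOD (N : ℤ)] → d t = 3 ^ (2 * k - 1) + δ)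
    (hdb : ∀ t : ℤ, t ≡ (b : ℤ) [ZMOD (N : ℤ)] → d t = 3 ^ (2 * k - 2))
    (hdo : ∀ t : ℤ, ¬ t ≡ (a : ℤ) [ZMOD (N : ℤ)] → ¬ t ≡ (b : ℤ) [ZMOD (N : ℤ)] →
      ∀ j : ℕ, 1 ≤ j → j ≤ n →
        t ≡ (jugAlpha j : ℤ) [ZMOD (3 : ℤ) ^ (2 * j - 1)] → d t = 3 ^ (2 * j - 1))
    (hd0 : ∀ t : ℤ, ¬ t ≡ (a : ℤ) [ZMOD (N : ℤ)] → ¬ t ≡ (b : ℤ) [ZMOD (N : ℤ)] →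
      (∀ j : ℕ, 1 ≤ j → j ≤ n →
        ¬ t ≡ (jugAlpha j : ℤ) [ZMOD (3 : ℤ) ^ (2 * j - 1)]) → d t = 0) :
    Function.Bijective (fun t : ℤ => t + (d t : ℤ)) := by
  obtain ⟨m, rfl⟩ := Nat.exists_eq_add_of_le' hk1
  have hpos : 0 < 3 ^ (2 * m) := by positivity
  have e2 : 2 * (m + 1) - 2 = 2 * m := by omega
  have e1 : 2 * (m + 1) - 1 = 2 * m + 1 := by omega
  have e3 : 2 * (m + 1 + 1) - 1 = 2 * (m + 1) + 1 := by omega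
  have ha' : a = jugAlpha (m + 1) + 3 ^ (2 * m) := by rw [ha, jugAlpha_succ hk1, e2]
  rw [e2] at hδ' hdb
  rw [e1] at hda
  have hb' : (b : ℤ) - a = δ := by omega
  have hNdvd : ∀ j : ℕ, j ≤ n → (3 : ℤ) ^ (2 * j - 1) ∣ (N : ℤ) := by
    intro j hj
    rw [hN]
    push_cast
    exact (pow_dvd_pow 3 (by omega)).mul_left 2
  have hab : ¬ (a : ℤ) ≡ b [ZMOD N] := by
    intro h
    have h1 := h.dvd
    rw [hb', Int.natCast_dvd_natCast] at h1
    have h2 := Nat.le_of_dvd (by omega) h1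
    have h3 : 3 ^ (2 * m + 3) ≤ 3 ^ (2 * n - 1) := Nat.pow_le_pow_right (by norm_num) (by omega)
    rw [pow_add] at h3
    omega
  have hta : ∀ t : ℤ, t ≡ a [ZMOD N] →
      t ≡ jugAlpha (m + 1 + 1) [ZMOD 3 ^ (2 * (m + 1 + 1) - 1)] := by
    intro t ht
    rw [ha] at ht
    exact ht.of_dvd (hNdvd _ (by omega))
  have htb : ∀ t : ℤ, t ≡ b [ZMOD N] →
      t ≡ jugAlpha (m + 1) [ZMOD 3 ^ (2 * (m + 1) - 1)] := by
    intro t ht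
    refine (ht.of_dvd (hNdvd _ (by omega))).trans (Int.modEq_iff_dvd.2 ?_)
    rw [hb]
    push_cast
    rw [sub_add_cancel_left, dvd_neg]
    exact pow_dvd_pow 3 (by omega)
  let e : ℤ → ℤ := fun t =>
    if t ≡ a [ZMOD N] then 3 ^ (2 * (m + 1) + 1)
    else if t ≡ b [ZMOD N] then 3 ^ (2 * m + 1) else d t
  have he : Function.Bijective fun t : ℤ => t + e t := by
    apply trivial_pattern_bijective_s9 n
    · intro t j h1 h2 h3
      by_cases hA : t ≡ a [ZMOD N]
      · obtain rfl := eq_of_modEq_jugAlpha_s9 h1 (by omega) h3 (hta t hA)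
        simp [e, hA, e3]
      · by_cases hB : t ≡ b [ZMOD N]
        · obtain rfl := eq_of_modEq_jugAlpha_s9 h1 (by omega) h3 (htb t hB)
          simp [e, hA, hB, e1]
        · simp [e, hA, hB, hdo t hA hB j h1 h2 h3]
    · intro t h
      have hA : ¬ t ≡ a [ZMOD N] := fun hA => h _ (by omega) (by omega) (hta t hA)
      have hB : ¬ t ≡ b [ZMOD N] := fun hB => h _ (by omega) (by omega) (htb t hB)
      simp [e, hA, hB, hd0 t hA hB h]
  convert he.comp (swap_residues_involutive hab).bijective using 1
  funext t
  simp only [Function.comp_apply, hb']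
  by_cases hA : t ≡ a [ZMOD N]
  · have h2 : t + (δ : ℤ) ≡ b [ZMOD N] := by simpa [← hb'] using hA.add_right (b - a : ℤ)
    have h3 : ¬ t + (δ : ℤ) ≡ a [ZMOD N] := fun h => hab (h.symm.trans h2)
    simp only [e, hA, h2, h3, if_true, if_false, hda t hA]
    push_cast
    ring
  · by_cases hB : t ≡ b [ZMOD N]
    · have h2 : t - (δ : ℤ) ≡ a [ZMOD N] := by simpa [← hb'] using hB.sub_right (b - a : ℤ)
      have hδz : (δ : ℤ) = 26 * 3 ^ (2 * m) := by exact_mod_cast hδ'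
      simp only [e, hA, hB, h2, if_true, if_false, hdb t hB]
      push_cast
      rw [hδz]
      ring
    · simp [e, hA, hB]
end

section
/- Let n ≥ 1 and let f : ℤ → ℤ be a bijection with f(t) > t for all t ∈ ℤ and f(t + n) = f(t) + n for all t ∈ ℤ. Consider the equivalence relation on ℤ generated by t ~ f(t) (so the equivalence classes are the orbits of the cyclic group of bijections generated by f acting on ℤ). Then the set of orbits is finite, and its cardinality b satisfies n·b = Σ_{i=0}^{n−1} (f(i) − i); i.e., the number of balls used in the juggling pattern f equals the number of orbits determined by f. -/
open Finset in
theorem sum_range_int_sub_of_periodic {n : ℕ} {g : ℤ → ℤ} (hg : Function.Periodic g n) (k : ℕ) :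
    ∑ i ∈ range n, g (i - k) = ∑ i ∈ range n, g i := by
  induction k with
  | zero => simp
  | succ k ih =>
    rw [← ih]
    have h1 := sum_range_succ (fun i : ℕ => g (i - (k + 1 : ℕ))) n
    have h2 := sum_range_succ' (fun i : ℕ => g (i - (k + 1 : ℕ))) n
    have h3 : g ((n : ℤ) - (k + 1 : ℕ)) = g (((0 : ℕ) : ℤ) - (k + 1 : ℕ)) := by
      rw [← hg (((0 : ℕ) : ℤ) - (k + 1 : ℕ))]
      exact congrArg g (by omega)
    have h4 : ∀ i : ℕ, g (((i + 1 : ℕ) : ℤ) - (k + 1 : ℕ)) = g (i - k) := fun i =>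
      congrArg g (by omega)
    simp only [h4] at h2
    linarith

theorem exists_nat_forall_le_of_periodic {n : ℕ} (hn : 1 ≤ n) {g : ℤ → ℤ}
    (hg : Function.Periodic g n) : ∃ K : ℕ, ∀ t, g t ≤ K := by
  refine ⟨∑ i ∈ Finset.range n, (g i).toNat, fun t => ?_⟩
  have hn' : (n : ℤ) ≠ 0 := by omega
  have h0 := Int.emod_nonneg t hn'
  have h1 := Int.emod_lt_of_pos t (show (0 : ℤ) < n by omega)
  have h2 : g t = g ((t % n).toNat : ℕ) := by
    rw [Int.toNat_of_nonneg h0, ← hg.int_mul (t / n) (t % n), Int.cast_id, mul_comm,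
      Int.emod_add_mul_ediv]
  have h3 := Finset.single_le_sum (f := fun i : ℕ => (g i).toNat) (fun _ _ => Nat.zero_le _)
    (Finset.mem_range.2 (show (t % n).toNat < n by omega))
  omega

theorem exists_crossing_of_forall_lt {f : ℤ → ℤ} (hsurj : Function.Surjective f)
    (hpos : ∀ t, t < f t) (T t : ℤ) :
    ∃ s, (s < T ∧ T ≤ f s) ∧
      Quot.mk (fun a b : ℤ => f a = b) s = Quot.mk (fun a b : ℤ => f a = b) t := by
  induction h : (T - t).natAbs using Nat.strong_induction_on generalizing t with
  | _ m ih =>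
    subst h
    by_cases ht : t < T
    · have h1 := hpos t
      by_cases hft : T ≤ f t
      · exact ⟨t, ⟨ht, hft⟩, rfl⟩
      · obtain ⟨s, hs, hst⟩ := ih _ (by omega) (f t) rfl
        exact ⟨s, hs, hst.trans (Quot.sound (r := fun a b : ℤ => f a = b) rfl).symm⟩
    · obtain ⟨u, rfl⟩ := hsurj t
      have h1 := hpos u
      by_cases hu : u < T
      · exact ⟨u, ⟨hu, by omega⟩, Quot.sound rfl⟩
      · obtain ⟨s, hs, hsu⟩ := ih _ (by omega) u rfl
        exact ⟨s, hs, hsu.trans (Quot.sound rfl)⟩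

theorem sameCycle_of_quot_mk_eq (σ : Equiv.Perm ℤ) {a b : ℤ}
    (h : Quot.mk (fun a b : ℤ => σ a = b) a = Quot.mk (fun a b : ℤ => σ a = b) b) :
    σ.SameCycle a b := by
  have := Quot.eqvGen_exact h
  induction this with
  | rel x y hxy => exact ⟨1, by simpa using hxy⟩
  | refl x => exact Equiv.Perm.SameCycle.refl _ _
  | symm x y _ ih => exact (ih (Quot.eqvGen_sound ‹_›)).symm
  | trans x y z _ _ ih₁ ih₂ =>
    exact (ih₁ (Quot.eqvGen_sound ‹_›)).trans (ih₂ (Quot.eqvGen_sound ‹_›))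

theorem eq_of_crossing_of_sameCycle {σ : Equiv.Perm ℤ} (hpos : ∀ t, t < σ t) {T a b : ℤ}
    (ha : a < T ∧ T ≤ σ a) (hb : b < T ∧ T ≤ σ b) (h : σ.SameCycle a b) : a = b := by
  obtain ⟨i, hi⟩ := h
  have hmono : StrictMono fun j : ℤ => (σ ^ j) a := strictMono_int_of_lt_succ fun j => by
    rw [add_comm, zpow_add, zpow_one, Equiv.Perm.mul_apply]
    exact hpos _
  rcases lt_trichotomy i 0 with h0 | rfl | h0
  · have h1 := hmono.monotone (show i + 1 ≤ 0 by omega)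
    simp only [add_comm i 1, zpow_add, zpow_one, Equiv.Perm.mul_apply, hi, zpow_zero,
      Equiv.Perm.one_apply] at h1
    omega
  · simpa using hi
  · have h1 := hmono.monotone (show 1 ≤ i by omega)
    simp only [hi, zpow_one] at h1
    omega

/-- The orbits of `f` correspond to the throws that are in the air just before time `T`. -/
theorem bijective_crossing_quot_mk {f : ℤ → ℤ} (hbij : Function.Bijective f)
    (hpos : ∀ t, t < f t) (T : ℤ) :
    Function.Bijective fun s : {s : ℤ // s < T ∧ T ≤ f s} =>
      Quot.mk (fun a b : ℤ => f a = b) s.1 := by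
  refine ⟨fun a b hab => Subtype.ext ?_, fun q => ?_⟩
  · exact eq_of_crossing_of_sameCycle (σ := Equiv.ofBijective f hbij) hpos a.2 b.2
      (sameCycle_of_quot_mk_eq (Equiv.ofBijective f hbij) hab)
  · induction q using Quot.ind with
    | _ t =>
      obtain ⟨s, hs, hst⟩ := exists_crossing_of_forall_lt hbij.surjective hpos T t
      exact ⟨⟨s, hs⟩, hst⟩

/-- Crossings of `T`, indexed by their distance to `T`. -/
def crossingEquiv {f : ℤ → ℤ} {K : ℕ} (hK : ∀ t, f t - t ≤ K) (T : ℤ) :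
    {s : ℤ // s < T ∧ T ≤ f s} ≃
      {k // k ∈ (Finset.range K).filter fun k : ℕ =>
        (k : ℤ) < f (T - (k + 1 : ℕ)) - (T - (k + 1 : ℕ))} where
  toFun s := ⟨(T - s.1 - 1).toNat, by
    obtain ⟨s, h1, h2⟩ := s
    have h3 := hK s
    have h4 : T - (((T - s - 1).toNat + 1 : ℕ) : ℤ) = s := by omega
    simp only [Finset.mem_filter, Finset.mem_range, h4]
    omega⟩
  invFun k := ⟨T - (k.1 + 1 : ℕ), by
    have h := (Finset.mem_filter.1 k.2).2
    omega⟩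
  left_inv s := Subtype.ext (by
    have := s.2.1
    simp only
    omega)
  right_inv k := Subtype.ext (by
    simp only
    omega)


/-- For a juggling pattern `f` of period `n` with all throw values positive,
the number of balls (the number of orbits of `f` on `ℤ`, i.e. equivalence
classes of the equivalence relation generated by `t ~ f(t)`) is finite and
equals the average throw value: `n · #orbits = Σ_{i=0}^{n−1} (f(i) − i)`. -/
theorem balls_eq_orbits (n : ℕ) (hn : 1 ≤ n) (f : ℤ → ℤ)
    (hbij : Function.Bijective f)
    (hpos : ∀ t : ℤ, t < f t)
    (hper : ∀ t : ℤ, f (t + n) = f t + n) :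
    Finite (Quot (fun a b : ℤ => f a = b)) ∧
      (n : ℤ) * (Nat.card (Quot (fun a b : ℤ => f a = b)) : ℤ) =
        ∑ i ∈ Finset.range n, (f i - i) := by
  have hg : Function.Periodic (fun t => f t - t) (n : ℤ) := fun t => by
    simp only [hper]
    ring
  obtain ⟨K, hK⟩ := exists_nat_forall_le_of_periodic hn hg
  have e (T : ℤ) := (Equiv.ofBijective _ (bijective_crossing_quot_mk hbij hpos T)).symm.trans
    (crossingEquiv hK T)
  refine ⟨Finite.of_equiv _ (e 0).symm, ?_⟩
  have hcard (T : ℤ) : (Nat.card (Quot (fun a b : ℤ => f a = b)) : ℤ) =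
      ∑ k ∈ Finset.range K,
        if (k : ℤ) < f (T - (k + 1 : ℕ)) - (T - (k + 1 : ℕ)) then (1 : ℤ) else 0 := by
    rw [Nat.card_congr (e T), Nat.card_eq_fintype_card, Fintype.card_coe, Finset.sum_boole]
  calc (n : ℤ) * (Nat.card (Quot (fun a b : ℤ => f a = b)) : ℤ)
      = ∑ T ∈ Finset.range n, (Nat.card (Quot (fun a b : ℤ => f a = b)) : ℤ) := by simp
    _ = ∑ T ∈ Finset.range n, ∑ k ∈ Finset.range K,
        if (k : ℤ) < f (T - (k + 1 : ℕ)) - (T - (k + 1 : ℕ)) then (1 : ℤ) else 0 :=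
      Finset.sum_congr rfl fun T _ => hcard T
    _ = ∑ k ∈ Finset.range K, ∑ i ∈ Finset.range n,
        if (k : ℤ) < f i - i then (1 : ℤ) else 0 := by
      rw [Finset.sum_comm]
      exact Finset.sum_congr rfl fun k _ => sum_range_int_sub_of_periodic
        (hg.comp fun d => if (k : ℤ) < d then (1 : ℤ) else 0) (k + 1)
    _ = ∑ i ∈ Finset.range n, (f i - i) := by
      rw [Finset.sum_comm]
      refine Finset.sum_congr rfl fun i _ => ?_
      have h1 := hK i
      have h2 := hpos i
      have h3 : (Finset.range K).filter (fun k : ℕ => (k : ℤ) < f i - i) =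
          Finset.range (f i - i).toNat := by
        ext k
        simp only [Finset.mem_filter, Finset.mem_range]
        omega
      rw [Finset.sum_boole, h3, Finset.card_range]
      omega
end
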